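/- Let 0 < a < b be real numbers. Then ℓ^b \ ℓ^a is maximal algebraically generic in ℓ^b, i.e. there exists a dense vector subspace F of ℓ^b with F ⊆ (ℓ^b \ ℓ^a) ∪ {0} and dim(F) = dim(ℓ^b). -/

import Mathlib

open Filter Topology

noncomputable section

/-- The topology generated by the open balls of a distance function `d`.
When `d` is an actual metric this is precisely the metric topology. -/
def topOfDist {α : Type*} (d : α → α → ℝ) : TopologicalSpace α :=
  TopologicalSpace.generateFrom {S | ∃ x r, S = {y | d x y < r}}

/-- The space `ℓ^p`, `0 < p < ∞`, of complex sequences. -/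
def lpSet (p : ℝ) : Set (ℕ → ℂ) := {x | Summable fun n => ‖x n‖ ^ p}

/-- The metric `d^p` of `ℓ^p`: the norm metric for `p ≥ 1`, and
`d^p(x,y) = Σ |x n - y n| ^ p` for `0 < p < 1`. -/
def dlp (p : ℝ) (x y : ℕ → ℂ) : ℝ :=
  if 1 ≤ p then (∑' n, ‖x n - y n‖ ^ p) ^ (1 / p) else ∑' n, ‖x n - y n‖ ^ p

/-- The topology of `ℓ^p` induced by the metric `d^p`. -/
def lpTopology (p : ℝ) : TopologicalSpace ↥(lpSet p) :=
  topOfDist fun x y => dlp p x.1 y.1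

theorem mem_lpSet_iff_memℓp {p : ℝ} (hp : 0 < p) (x : ℕ → ℂ) :
    x ∈ lpSet p ↔ Memℓp x (ENNReal.ofReal p) := by
  rw [memℓp_gen_iff (by rwa [ENNReal.toReal_ofReal hp.le]), ENNReal.toReal_ofReal hp.le]
  rfl

/-- `ℓ^p` as a vector subspace of the space of all sequences. -/
def lpSeqSubmodule (p : ℝ) (hp : 0 < p) : Submodule ℂ (ℕ → ℂ) where
  carrier := lpSet p
  zero_mem' := by
    rw [mem_lpSet_iff_memℓp hp]
    exact zero_memℓp
  add_mem' := by
    intro x y hx hy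
    rw [mem_lpSet_iff_memℓp hp] at *
    exact hx.add hy
  smul_mem' := by
    intro c x hx
    rw [mem_lpSet_iff_memℓp hp] at *
    exact hx.const_smul c

theorem dlp_triangle {p : ℝ} (hp : 0 < p) {x y z : ℕ → ℂ}
    (hx : x ∈ lpSet p) (hy : y ∈ lpSet p) (hz : z ∈ lpSet p) :
    dlp p x z ≤ dlp p x y + dlp p y z := by
  have hxy : Summable fun n => ‖x n - y n‖ ^ p := (lpSeqSubmodule p hp).sub_mem hx hy
  have hyz : Summable fun n => ‖y n - z n‖ ^ p := (lpSeqSubmodule p hp).sub_mem hy hz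
  have hxz : Summable fun n => ‖x n - z n‖ ^ p := (lpSeqSubmodule p hp).sub_mem hx hz
  have tri (n : ℕ) : ‖x n - z n‖ ≤ ‖x n - y n‖ + ‖y n - z n‖ := norm_sub_le_norm_sub_add_norm_sub ..
  unfold dlp
  split_ifs with h1
  · obtain ⟨hs, hle⟩ := Real.Lp_add_le_tsum_of_nonneg h1 (fun n => norm_nonneg (x n - y n))
      (fun n => norm_nonneg (y n - z n)) hxy hyz
    refine le_trans ?_ hle
    refine Real.rpow_le_rpow (tsum_nonneg fun n => by positivity) ?_ (by positivity)
    exact hxz.tsum_le_tsum (fun n => Real.rpow_le_rpow (norm_nonneg _) (tri n) hp.le) hs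
  · rw [← hxy.tsum_add hyz]
    refine hxz.tsum_le_tsum (fun n => ?_) (hxy.add hyz)
    exact (Real.rpow_le_rpow (norm_nonneg _) (tri n) hp.le).trans
      (Real.rpow_add_le_add_rpow (norm_nonneg _) (norm_nonneg _) hp.le (not_le.1 h1).le)

theorem tendsto_lpTopology {p : ℝ} (hp : 0 < p) {x : lpSet p} {u : ℕ → lpSet p}
    (h : Tendsto (fun k => ∑' n, ‖x.1 n - (u k).1 n‖ ^ p) atTop (𝓝 0)) :
    Tendsto u atTop (@nhds _ (lpTopology p) x) := by
  have hd : Tendsto (fun k => dlp p x.1 (u k).1) atTop (𝓝 0) := by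
    unfold dlp
    split_ifs with h1
    · have := h.rpow_const (p := 1 / p) (Or.inr (by positivity))
      rwa [Real.zero_rpow (by positivity)] at this
    · exact h
  refine TopologicalSpace.tendsto_nhds_generateFrom_iff.2 ?_
  rintro _ ⟨c, r, rfl⟩ hc
  have hc' : dlp p c.1 x.1 < r := hc
  filter_upwards [hd.eventually_lt_const (sub_pos.2 hc')] with k hk
  have := dlp_triangle hp c.2 x.2 (u k).2
  change dlp p c.1 (u k).1 < r
  linarith

/-- The sequence `(n + 1) ^ (-s)`. -/
def powSeq (s : ℝ) (n : ℕ) : ℂ := (((n : ℝ) + 1) ^ (-s) : ℝ)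

theorem norm_powSeq (s : ℝ) (n : ℕ) : ‖powSeq s n‖ = ((n : ℝ) + 1) ^ (-s) := by
  rw [powSeq, Complex.norm_real, Real.norm_of_nonneg (by positivity)]

theorem powSeq_ne_zero (s : ℝ) (n : ℕ) : powSeq s n ≠ 0 := by
  rw [← norm_ne_zero_iff, norm_powSeq]
  positivity

theorem norm_powSeq_anti {s t : ℝ} (h : s ≤ t) (n : ℕ) : ‖powSeq t n‖ ≤ ‖powSeq s n‖ := by
  simp only [norm_powSeq]
  exact Real.rpow_le_rpow_of_exponent_le (by linarith [n.cast_nonneg (α := ℝ)]) (by linarith)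

theorem powSeq_mem_lpSet_iff {p s : ℝ} : powSeq s ∈ lpSet p ↔ 1 < s * p := by
  rw [← Real.summable_nat_rpow_inv, ← summable_nat_add_iff 1]
  refine summable_congr fun n => ?_
  rw [norm_powSeq, ← Real.rpow_mul (by positivity), neg_mul, Real.rpow_neg (by positivity)]
  push_cast
  rfl

theorem tendsto_powSeq_div {s t : ℝ} (h : s < t) :
    Tendsto (fun n => powSeq t n / powSeq s n) atTop (𝓝 0) := by
  rw [tendsto_zero_iff_norm_tendsto_zero]
  have h1 : Tendsto (fun n : ℕ => (n : ℝ) + 1) atTop atTop :=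
    tendsto_atTop_add_const_right _ _ tendsto_natCast_atTop_atTop
  refine ((tendsto_rpow_neg_atTop (sub_pos.2 h)).comp h1).congr fun n => ?_
  rw [norm_div, norm_powSeq, norm_powSeq, ← Real.rpow_sub (by positivity), Function.comp_apply]
  congr 1
  ring

/-- A sequence eventually equal to a nontrivial combination of powers `(n + 1) ^ (-s i)`, with
distinct `s i ≤ 1 / p`, is not in `ℓ^p`. -/
theorem notMem_lpSet_of_eventuallyEq {ι : Type*} {p : ℝ} (hp : 0 < p) {s : ι → ℝ}
    (hs : Function.Injective s) (hsp : ∀ i, s i * p ≤ 1) {c : ι →₀ ℂ} (hc : c ≠ 0)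
    {f : ℕ → ℂ} (hf : f =ᶠ[atTop] fun n => ∑ i ∈ c.support, c i * powSeq (s i) n) :
    f ∉ lpSet p := by
  classical
  obtain ⟨i₀, hi₀, hmin⟩ := c.support.exists_min_image s (Finsupp.support_nonempty_iff.2 hc)
  have hlim : Tendsto (fun n => f n / powSeq (s i₀) n) atTop (𝓝 (c i₀)) := by
    have hsum : Tendsto (fun n => ∑ i ∈ c.support, c i * (powSeq (s i) n / powSeq (s i₀) n))
        atTop (𝓝 (∑ i ∈ c.support, if i = i₀ then c i else 0)) := by
      refine tendsto_finsetSum _ fun i hi => ?_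
      split_ifs with h
      · subst h
        simp [div_self (powSeq_ne_zero _ _)]
      · simpa using (tendsto_powSeq_div
          (lt_of_le_of_ne (hmin i hi) fun e => h (hs e).symm)).const_mul (c i)
    rw [Finset.sum_ite_eq' c.support i₀ c, if_pos hi₀] at hsum
    refine hsum.congr' ?_
    filter_upwards [hf] with n hn
    rw [hn, Finset.sum_div]
    exact Finset.sum_congr rfl fun i _ => (mul_div_assoc ..).symm
  have hpos : 0 < ‖c i₀‖ := norm_pos_iff.2 (Finsupp.mem_support_iff.1 hi₀)
  intro hmem
  refine (hsp i₀).not_gt (powSeq_mem_lpSet_iff.1 ?_)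
  have hS : Summable fun n => (2 / ‖c i₀‖) ^ p * ‖f n‖ ^ p := Summable.mul_left _ hmem
  refine hS.of_norm_bounded_eventually_nat ?_
  filter_upwards [hlim.norm.eventually_const_lt (half_lt_self hpos)] with n hn
  have hv : 0 < ‖powSeq (s i₀) n‖ := norm_pos_iff.2 (powSeq_ne_zero _ _)
  rw [norm_div, lt_div_iff₀ hv] at hn
  rw [Real.norm_of_nonneg (by positivity), ← Real.mul_rpow (by positivity) (by positivity)]
  refine Real.rpow_le_rpow hv.le ?_ hp.le
  rw [div_mul_eq_mul_div, le_div_iff₀ hpos]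
  linarith

/-- The first `k` terms of `x`, perturbed by a small multiple of `(n + 1) ^ (-s)`. -/
def perturbedTrunc (s : ℝ) (x : ℕ → ℂ) (k : ℕ) : ℕ → ℂ :=
  fun n => (if n < k then x n else 0) + ((k : ℂ) + 1)⁻¹ * powSeq s n

theorem perturbedTrunc_mem_lpSet {p s : ℝ} (hp : 0 < p) (hs : 1 < s * p) (x : ℕ → ℂ) (k : ℕ) :
    perturbedTrunc s x k ∈ lpSet p := by
  refine (lpSeqSubmodule p hp).add_mem (x := fun n => if n < k then x n else 0) ?_
    ((lpSeqSubmodule p hp).smul_mem ((k : ℂ) + 1)⁻¹ (powSeq_mem_lpSet_iff.2 hs))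
  refine summable_of_ne_finset_zero (s := Finset.range k) fun n hn => ?_
  rw [Finset.mem_range] at hn
  simp [hn, hp.ne']

theorem tendsto_tsum_sub_perturbedTrunc {p s₀ : ℝ} (hp : 0 < p) (hs₀ : 1 < s₀ * p)
    {s : ℕ → ℝ} (hs : ∀ k, s₀ ≤ s k) {x : ℕ → ℂ} (hx : x ∈ lpSet p) :
    Tendsto (fun k => ∑' n, ‖x n - perturbedTrunc (s k) x k n‖ ^ p) atTop (𝓝 0) := by
  have hx' : (fun n => (‖x n‖ : ℂ)) ∈ lpSet p := by simpa [lpSet] using hx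
  have hy' : (fun n => (‖powSeq s₀ n‖ : ℂ)) ∈ lpSet p := by
    simpa [lpSet] using powSeq_mem_lpSet_iff.2 hs₀
  have hbound : Summable fun n => ‖(‖x n‖ : ℂ) + (‖powSeq s₀ n‖ : ℂ)‖ ^ p :=
    (lpSeqSubmodule p hp).add_mem hx' hy'
  have hinv (k : ℕ) : ‖((k : ℂ) + 1)⁻¹‖ = 1 / ((k : ℝ) + 1) := by
    rw [norm_inv, one_div]
    norm_cast
  have hsmall (n k : ℕ) :
      ‖((k : ℂ) + 1)⁻¹ * powSeq (s k) n‖ ≤ 1 / ((k : ℝ) + 1) * ‖powSeq s₀ n‖ := by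
    rw [norm_mul, hinv]
    exact mul_le_mul_of_nonneg_left (norm_powSeq_anti (hs k) n) (by positivity)
  have hone (k : ℕ) : 1 / ((k : ℝ) + 1) ≤ 1 := by
    rw [div_le_one (by positivity)]
    linarith [k.cast_nonneg (α := ℝ)]
  rw [← tsum_zero (α := ℝ) (β := ℕ)]
  refine tendsto_tsum_of_dominated_convergence hbound (fun n => ?_)
    (Eventually.of_forall fun k n => ?_)
  · have h0 : Tendsto (fun k => ‖x n - perturbedTrunc (s k) x k n‖) atTop (𝓝 0) := by
      have hz : Tendsto (fun k : ℕ => 1 / ((k : ℝ) + 1) * ‖powSeq s₀ n‖) atTop (𝓝 0) := by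
        simpa using tendsto_one_div_add_atTop_nhds_zero_nat.mul_const ‖powSeq s₀ n‖
      refine squeeze_zero' (Eventually.of_forall fun k => norm_nonneg _) ?_ hz
      filter_upwards [eventually_gt_atTop n] with k hk
      simpa [perturbedTrunc, hk] using hsmall n k
    simpa [hp.ne'] using h0.rpow_const (p := p) (Or.inr hp.le)
  · rw [Real.norm_of_nonneg (by positivity)]
    refine Real.rpow_le_rpow (norm_nonneg _) ?_ hp.le
    have hnn : ‖(‖x n‖ : ℂ) + (‖powSeq s₀ n‖ : ℂ)‖ = ‖x n‖ + ‖powSeq s₀ n‖ := by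
      rw [← Complex.ofReal_add, Complex.norm_real, Real.norm_of_nonneg (by positivity)]
    rw [hnn, perturbedTrunc, ← sub_sub]
    refine (norm_sub_le _ _).trans (add_le_add ?_ ((hsmall n k).trans ?_))
    · split_ifs <;> simp
    · exact mul_le_of_le_one_left (norm_nonneg _) (hone k)

theorem exists_injective_Ioo {s t : ℝ} (h : s < t) :
    ∃ φ : (ℕ → ℂ) × ℕ → ℝ, Function.Injective φ ∧ ∀ i, φ i ∈ Set.Ioo s t := by
  have hcard : Cardinal.mk ((ℕ → ℂ) × ℕ) ≤ Cardinal.mk (Set.Ioo s t) := by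
    rw [Cardinal.mk_Ioo_real h]
    simp
  obtain ⟨e⟩ := hcard
  exact ⟨fun i => (e i).1, Subtype.val_injective.comp e.injective, fun i => (e i).2⟩

theorem linearCombination_perturbedTrunc_notMem_lpSet {p : ℝ} (hp : 0 < p)
    {φ : (ℕ → ℂ) × ℕ → ℝ} (hφ : Function.Injective φ) (hφp : ∀ i, φ i * p ≤ 1)
    {c : (ℕ → ℂ) × ℕ →₀ ℂ} (hc : c ≠ 0) :
    Finsupp.linearCombination ℂ (fun i => perturbedTrunc (φ i) i.1 i.2) c ∉ lpSet p := by
  have hk (i : (ℕ → ℂ) × ℕ) : ((i.2 : ℂ) + 1)⁻¹ ≠ 0 := inv_ne_zero (Nat.cast_add_one_ne_zero _)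
  let c' : (ℕ → ℂ) × ℕ →₀ ℂ := Finsupp.onFinset c.support
    (fun i => c i * ((i.2 : ℂ) + 1)⁻¹) fun i hi => Finsupp.mem_support_iff.2 (left_ne_zero_of_mul hi)
  have hsupp : c'.support = c.support := by
    ext i
    simp only [Finsupp.mem_support_iff, c', Finsupp.onFinset_apply, ne_eq, mul_eq_zero, hk,
      or_false]
  have hc' : c' ≠ 0 := by
    rwa [← Finsupp.support_nonempty_iff, hsupp, Finsupp.support_nonempty_iff]
  refine notMem_lpSet_of_eventuallyEq hp hφ hφp hc' ?_
  have hev : ∀ᶠ n in atTop, ∀ i ∈ c.support, i.2 ≤ n :=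
    (Finset.eventually_all c.support).2 fun i _ => eventually_ge_atTop i.2
  filter_upwards [hev] with n hn
  rw [Finsupp.linearCombination_apply, Finsupp.sum, Finset.sum_apply, hsupp]
  refine Finset.sum_congr rfl fun i hi => ?_
  simp [perturbedTrunc, c', (hn i hi).not_gt, mul_assoc]

/-- Let `0 < a < b`. Then `ℓ^b \ ℓ^a` is maximal algebraically generic in `ℓ^b`:
there is a dense vector subspace `F` of `ℓ^b` (with its metric topology) with
`F ⊆ (ℓ^b \ ℓ^a) ∪ {0}` and `dim F = dim ℓ^b`. -/
theorem statement12 (a b : ℝ) (ha : 0 < a) (hab : a < b) :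
    ∃ F : Submodule ℂ (ℕ → ℂ),
      (F : Set (ℕ → ℂ)) ⊆ lpSet b ∧
      @Dense ↥(lpSet b) (lpTopology b) (Subtype.val ⁻¹' (F : Set (ℕ → ℂ))) ∧
      (∀ v ∈ F, v ≠ 0 → v ∉ lpSet a) ∧
      Module.rank ℂ F = Module.rank ℂ (Submodule.span ℂ (lpSet b)) := by
  have hb : 0 < b := ha.trans hab
  obtain ⟨s₀, hs₀b, hs₀a⟩ := exists_between (one_div_lt_one_div_of_lt ha hab)
  obtain ⟨φ, hφ, hφI⟩ := exists_injective_Ioo hs₀a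
  have hφa (i) : φ i * a ≤ 1 := ((lt_div_iff₀ ha).1 (hφI i).2).le
  have hs₀ : 1 < s₀ * b := (div_lt_iff₀ hb).1 hs₀b
  have hφb (i) : 1 < φ i * b := (div_lt_iff₀ hb).1 (hs₀b.trans (hφI i).1)
  let w : (ℕ → ℂ) × ℕ → ℕ → ℂ := fun i => perturbedTrunc (φ i) i.1 i.2
  have hw (i) : w i ∈ lpSet b := perturbedTrunc_mem_lpSet hb (hφb i) _ _
  have hindep : LinearIndependent ℂ w := by
    rw [linearIndependent_iff]
    intro c hc
    by_contra hne
    refine linearCombination_perturbedTrunc_notMem_lpSet ha hφ hφa hne ?_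
    exact hc ▸ (lpSeqSubmodule a ha).zero_mem
  have hsub : Submodule.span ℂ (Set.range w) ≤ lpSeqSubmodule b hb :=
    Submodule.span_le.2 (Set.range_subset_iff.2 hw)
  refine ⟨Submodule.span ℂ (Set.range w), hsub, ?_, ?_, le_antisymm ?_ ?_⟩
  · let _ : TopologicalSpace (lpSet b) := lpTopology b
    intro x
    refine mem_closure_of_tendsto (b := atTop)
      (f := fun k : ℕ => (⟨w (x.1, k), hw _⟩ : lpSet b)) ?_
      (Eventually.of_forall fun k => Submodule.subset_span (Set.mem_range_self (x.1, k)))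
    exact tendsto_lpTopology hb (tendsto_tsum_sub_perturbedTrunc hb hs₀
      (s := fun k => φ (x.1, k)) (fun k => (hφI _).1.le) x.2)
  · intro v hv hv0
    obtain ⟨c, rfl⟩ := (Finsupp.mem_span_range_iff_exists_finsupp).1 hv
    refine linearCombination_perturbedTrunc_notMem_lpSet ha hφ hφa (c := c) ?_
    rintro rfl
    exact hv0 Finsupp.sum_zero_index
  · exact Submodule.rank_mono (Submodule.span_mono (Set.range_subset_iff.2 hw))
  · rw [rank_span hindep, Cardinal.mk_range_eq w hindep.injective]
    calc Module.rank ℂ (Submodule.span ℂ (lpSet b)) ≤ Module.rank ℂ (ℕ → ℂ) :=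
          Submodule.rank_le _
      _ ≤ Cardinal.mk (ℕ → ℂ) := rank_le_card ..
      _ ≤ Cardinal.mk ((ℕ → ℂ) × ℕ) := Cardinal.mk_le_of_injective (Prod.mk_left_injective 0)

end
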